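/- arXiv:1511.03301 — 6 statements merged into one kernel-verified Lean document; each statement's English description precedes it below -/
import Mathlib

section
/- Suppose (η_i, η_f) ≠ (0, 0). Then the 8×8 Hermitian matrix H₀ has exactly three distinct eigenvalues: −2ωℏχ with multiplicity 2, 0 with multiplicity 4, and +2ωℏχ with multiplicity 2; equivalently, its characteristic polynomial is (x − 2ωℏχ)² (x + 2ωℏχ)² x⁴. In particular the spectral gap between the ground energy and the first excited energy equals 2ωℏχ > 0. -/
open Matrix
open scoped Kronecker

/-- Pauli matrix `X`. -/
def pauliX : Matrix (Fin 2) (Fin 2) ℂ := !![0, 1; 1, 0]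

/-- Pauli matrix `Z`. -/
def pauliZ : Matrix (Fin 2) (Fin 2) ℂ := !![1, 0; 0, -1]

/-- The adiabatic teleportation Hamiltonian
`H₀ = −ωℏ[ η_i(𝟙⊗X⊗X + 𝟙⊗Z⊗Z) + η_f(X⊗X⊗𝟙 + Z⊗Z⊗𝟙) ]`. -/
noncomputable def H₀tel (ω ℏ ηi ηf : ℝ) :
    Matrix (Fin 2 × Fin 2 × Fin 2) (Fin 2 × Fin 2 × Fin 2) ℂ :=
  (-(ω * ℏ) : ℂ) •
    ((ηi : ℂ) • ((1 : Matrix (Fin 2) (Fin 2) ℂ) ⊗ₖ (pauliX ⊗ₖ pauliX)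
        + (1 : Matrix (Fin 2) (Fin 2) ℂ) ⊗ₖ (pauliZ ⊗ₖ pauliZ))
      + (ηf : ℂ) • (pauliX ⊗ₖ (pauliX ⊗ₖ (1 : Matrix (Fin 2) (Fin 2) ℂ))
        + pauliZ ⊗ₖ (pauliZ ⊗ₖ (1 : Matrix (Fin 2) (Fin 2) ℂ))))

/-- The splitting of the three-qubit computational basis into its even- and odd-parity parts,
the odd states listed as the bit flips of the even ones. -/
def parityEquiv : Fin 4 ⊕ Fin 4 ≃ Fin 2 × Fin 2 × Fin 2 where
  toFun := Sum.elim ![(0, 0, 0), (0, 1, 1), (1, 0, 1), (1, 1, 0)]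
    ![(1, 1, 1), (1, 0, 0), (0, 1, 0), (0, 0, 1)]
  invFun p := ![![![.inl 0, .inr 3], ![.inr 2, .inl 1]],
    ![![.inr 1, .inl 2], ![.inl 3, .inr 0]]] p.1 p.2.1 p.2.2
  left_inv := by decide
  right_inv := by decide

/-- The common form of the blocks of the teleportation Hamiltonian on the two parity sectors. -/
def parityBlock (s a b : ℂ) : Matrix (Fin 4) (Fin 4) ℂ :=
  s • !![a + b, a, 0, b; a, a - b, b, 0; 0, b, -a - b, a; b, 0, a, b - a]

lemma H₀tel_submatrix_parityEquiv (ω ℏ ηi ηf : ℝ) :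
    (H₀tel ω ℏ ηi ηf).submatrix parityEquiv parityEquiv =
      fromBlocks (parityBlock (-(ω * ℏ)) ηi ηf) 0 0 (parityBlock (-(ω * ℏ)) ηi ηf) := by
  ext i j
  rcases i with i | i <;> rcases j with j | j <;> fin_cases i <;> fin_cases j <;>
    simp [H₀tel, parityEquiv, parityBlock, pauliX, pauliZ] <;> ring

lemma charpoly_parityBlock (s a b : ℂ) :
    (parityBlock s a b).charpoly =
      (Polynomial.X ^ 2 - Polynomial.C (4 * s ^ 2 * (a ^ 2 + b ^ 2))) * Polynomial.X ^ 2 := by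
  rw [Matrix.charpoly, det_succ_row_zero]
  simp [parityBlock, charmatrix_apply, det_fin_three, Fin.sum_univ_succ, submatrix_apply,
    Fin.succAbove, diagonal_apply, map_ofNat Polynomial.C 4]
  ring

/-- For `(η_i, η_f) ≠ (0,0)`, the characteristic polynomial of the 8×8
Hermitian matrix `H₀` is `(x − 2ωℏχ)²(x + 2ωℏχ)² x⁴` (i.e. the eigenvalues are `−2ωℏχ`
with multiplicity 2, `0` with multiplicity 4 and `+2ωℏχ` with multiplicity 2), and the
spectral gap `2ωℏχ` is positive, where `χ = √(η_i² + η_f²)`. -/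
theorem charpoly_H₀tel (ω ℏ ηi ηf : ℝ) (hω : 0 < ω) (hℏ : 0 < ℏ)
    (hη : ¬(ηi = 0 ∧ ηf = 0)) :
    (H₀tel ω ℏ ηi ηf).charpoly =
      (Polynomial.X - Polynomial.C ((2 * ω * ℏ * Real.sqrt (ηi ^ 2 + ηf ^ 2) : ℝ) : ℂ)) ^ 2 *
      (Polynomial.X + Polynomial.C ((2 * ω * ℏ * Real.sqrt (ηi ^ 2 + ηf ^ 2) : ℝ) : ℂ)) ^ 2 *
      Polynomial.X ^ 4 ∧
    0 < 2 * ω * ℏ * Real.sqrt (ηi ^ 2 + ηf ^ 2) := by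
  constructor
  · have hsq : ((Real.sqrt (ηi ^ 2 + ηf ^ 2) : ℝ) : ℂ) ^ 2 = (ηi : ℂ) ^ 2 + (ηf : ℂ) ^ 2 := by
      exact_mod_cast Real.sq_sqrt (by positivity : 0 ≤ ηi ^ 2 + ηf ^ 2)
    have hcoeff : 4 * (-(ω * ℏ) : ℂ) ^ 2 * ((ηi : ℂ) ^ 2 + (ηf : ℂ) ^ 2) =
        ((2 * ω * ℏ * Real.sqrt (ηi ^ 2 + ηf ^ 2) : ℝ) : ℂ) ^ 2 := by
      rw [← hsq]
      push_cast
      ring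
    have hblocks : (H₀tel ω ℏ ηi ηf).charpoly =
        (parityBlock (-(ω * ℏ)) ηi ηf).charpoly * (parityBlock (-(ω * ℏ)) ηi ηf).charpoly := by
      rw [← charpoly_reindex parityEquiv.symm, reindex_apply, Equiv.symm_symm,
        H₀tel_submatrix_parityEquiv, charpoly_fromBlocks_zero₁₂]
    rw [hblocks, charpoly_parityBlock, hcoeff, Polynomial.C_pow]
    ring
  · have hpos : 0 < ηi ^ 2 + ηf ^ 2 := by
      by_contra! h
      exact hη ⟨by nlinarith [sq_nonneg ηi, sq_nonneg ηf],
        by nlinarith [sq_nonneg ηi, sq_nonneg ηf]⟩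
    positivity
end

section
/- The matrix H₀ commutes with both parity operators Π_z = Z⊗Z⊗Z and Π_x = X⊗X⊗X, i.e., H₀ Π_z = Π_z H₀ and H₀ Π_x = Π_x H₀, for all real values of η_i and η_f. -/
open Matrix
open scoped Kronecker

theorem pauliX_mul_pauliZ : pauliX * pauliZ = -(pauliZ * pauliX) := by
  ext i j
  fin_cases i <;> fin_cases j <;> simp [pauliX, pauliZ]

theorem Matrix.neg_kronecker_neg {l m n p R : Type*} [Ring R]
    (A : Matrix l m R) (B : Matrix n p R) : (-A) ⊗ₖ (-B) = A ⊗ₖ B := by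
  ext i j
  simp [kroneckerMap_apply]

theorem Commute.kronecker {m n R : Type*} [Fintype m] [Fintype n] [CommRing R]
    {A C : Matrix m m R} {B D : Matrix n n R} (hAC : Commute A C) (hBD : Commute B D) :
    Commute (A ⊗ₖ B) (C ⊗ₖ D) := by
  rw [Commute, SemiconjBy, ← mul_kronecker_mul, ← mul_kronecker_mul, hAC.eq, hBD.eq]

/-- Two pairs of anticommuting matrices have commuting Kronecker products. -/
theorem Matrix.commute_kronecker_of_anticommute {m n R : Type*} [Fintype m] [Fintype n]
    [CommRing R] {A C : Matrix m m R} {B D : Matrix n n R}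
    (hAC : A * C = -(C * A)) (hBD : B * D = -(D * B)) :
    Commute (A ⊗ₖ B) (C ⊗ₖ D) := by
  rw [Commute, SemiconjBy, ← mul_kronecker_mul, ← mul_kronecker_mul, hAC, hBD,
    neg_kronecker_neg]

/-- `H₀` commutes with `P ⊗ P ⊗ P` if its two-site couplings commute with `P ⊗ P`. -/
theorem H₀tel_commute_of_commute {P : Matrix (Fin 2) (Fin 2) ℂ}
    (hX : Commute (pauliX ⊗ₖ pauliX) (P ⊗ₖ P)) (hZ : Commute (pauliZ ⊗ₖ pauliZ) (P ⊗ₖ P))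
    (ω ℏ ηi ηf : ℝ) : Commute (H₀tel ω ℏ ηi ηf) (P ⊗ₖ (P ⊗ₖ P)) := by
  have right_assoc {A : Matrix (Fin 2) (Fin 2) ℂ} (h : Commute (A ⊗ₖ A) (P ⊗ₖ P)) :
      Commute (A ⊗ₖ (A ⊗ₖ (1 : Matrix (Fin 2) (Fin 2) ℂ))) (P ⊗ₖ (P ⊗ₖ P)) := by
    have h' := (h.kronecker (Commute.one_left P)).map
      (reindexAlgEquiv ℂ ℂ (Equiv.prodAssoc (Fin 2) (Fin 2) (Fin 2)))
    simpa only [coe_reindexAlgEquiv, kronecker_assoc] using h'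
  unfold H₀tel
  exact (((((Commute.one_left P).kronecker hX).add_left
    ((Commute.one_left P).kronecker hZ)).smul_left _).add_left
    (((right_assoc hX).add_left (right_assoc hZ)).smul_left _)).smul_left _

/-- The adiabatic teleportation Hamiltonian `H₀` commutes with both
parity operators `Π_z = Z⊗Z⊗Z` and `Π_x = X⊗X⊗X`, for all real `η_i`, `η_f`. -/
theorem H₀tel_commutes_with_parities (ω ℏ : ℝ) (hω : 0 < ω) (hℏ : 0 < ℏ) :
    ∀ ηi ηf : ℝ,
      H₀tel ω ℏ ηi ηf * (pauliZ ⊗ₖ (pauliZ ⊗ₖ pauliZ)) =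
        (pauliZ ⊗ₖ (pauliZ ⊗ₖ pauliZ)) * H₀tel ω ℏ ηi ηf ∧
      H₀tel ω ℏ ηi ηf * (pauliX ⊗ₖ (pauliX ⊗ₖ pauliX)) =
        (pauliX ⊗ₖ (pauliX ⊗ₖ pauliX)) * H₀tel ω ℏ ηi ηf := by
  have hXZ := commute_kronecker_of_anticommute pauliX_mul_pauliZ pauliX_mul_pauliZ
  intro ηi ηf
  exact ⟨(H₀tel_commute_of_commute hXZ (Commute.refl _) ω ℏ ηi ηf).eq,
    (H₀tel_commute_of_commute (Commute.refl _) hXZ.symm ω ℏ ηi ηf).eq⟩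
end

section
/- Let V be a unitary operator on ℂ² ⊗ ℂ² ⊗ ℂ² that commutes with Π_z = Z⊗Z⊗Z and with Π_x = X⊗X⊗X, and suppose that for every ψ ∈ ℂ² there exists v(ψ) ∈ ℂ² such that V(ψ ⊗ β₀₀) = β₀₀ ⊗ v(ψ). Then there exists a real number θ such that V(ψ ⊗ β₀₀) = e^{iθ} (β₀₀ ⊗ ψ) for every ψ ∈ ℂ², i.e., the evolution teleports the state of the first qubit to the third qubit exactly, up to a global phase independent of ψ. -/
open Matrix
open scoped Kronecker

/-- The Bell state `β₀₀ = (e₀⊗e₀ + e₁⊗e₁)/√2 ∈ ℂ² ⊗ ℂ²`. -/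
noncomputable def bell : Fin 2 × Fin 2 → ℂ :=
  fun p => (if p.1 = p.2 then 1 else 0) / ((Real.sqrt 2 : ℝ) : ℂ)

/-- The encoded input `ψ ⊗ β₀₀`. -/
noncomputable def tensorBell (ψ : Fin 2 → ℂ) : Fin 2 × Fin 2 × Fin 2 → ℂ :=
  fun p => ψ p.1 * bell p.2

/-- The teleported output `β₀₀ ⊗ v`. -/
noncomputable def bellTensor (v : Fin 2 → ℂ) : Fin 2 × Fin 2 × Fin 2 → ℂ :=
  fun p => bell (p.1, p.2.1) * v p.2.2

theorem bell_self_ne_zero (i : Fin 2) : bell (i, i) ≠ 0 := by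
  simp [bell]

theorem bellTensor_injective : Function.Injective bellTensor := fun _ _ hvw =>
  funext fun i => mul_left_cancel₀ (bell_self_ne_zero 0) (congrFun hvw (0, 0, i))

theorem tensorBell_add (ψ φ : Fin 2 → ℂ) :
    tensorBell (ψ + φ) = tensorBell ψ + tensorBell φ := by
  ext p
  simp [tensorBell, add_mul]

theorem tensorBell_smul (c : ℂ) (ψ : Fin 2 → ℂ) :
    tensorBell (c • ψ) = c • tensorBell ψ := by
  ext p
  simp [tensorBell, mul_assoc]

theorem bellTensor_add (v w : Fin 2 → ℂ) :
    bellTensor (v + w) = bellTensor v + bellTensor w := by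
  ext p
  simp [bellTensor, mul_add]

theorem bellTensor_smul (c : ℂ) (v : Fin 2 → ℂ) :
    bellTensor (c • v) = c • bellTensor v := by
  ext p
  simp [bellTensor, mul_left_comm]

theorem pauliZ_kronecker_mulVec_tensorBell (ψ : Fin 2 → ℂ) :
    (pauliZ ⊗ₖ (pauliZ ⊗ₖ pauliZ)) *ᵥ tensorBell ψ = tensorBell (pauliZ *ᵥ ψ) := by
  ext ⟨i, j, k⟩
  fin_cases i <;> fin_cases j <;> fin_cases k <;>
    simp [mulVec, dotProduct, Fintype.sum_prod_type, tensorBell, bell, pauliZ]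

theorem pauliX_kronecker_mulVec_tensorBell (ψ : Fin 2 → ℂ) :
    (pauliX ⊗ₖ (pauliX ⊗ₖ pauliX)) *ᵥ tensorBell ψ = tensorBell (pauliX *ᵥ ψ) := by
  ext ⟨i, j, k⟩
  fin_cases i <;> fin_cases j <;> fin_cases k <;>
    simp [mulVec, dotProduct, Fintype.sum_prod_type, tensorBell, bell, pauliX]

theorem pauliZ_kronecker_mulVec_bellTensor (v : Fin 2 → ℂ) :
    (pauliZ ⊗ₖ (pauliZ ⊗ₖ pauliZ)) *ᵥ bellTensor v = bellTensor (pauliZ *ᵥ v) := by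
  ext ⟨i, j, k⟩
  fin_cases i <;> fin_cases j <;> fin_cases k <;>
    simp [mulVec, dotProduct, Fintype.sum_prod_type, bellTensor, bell, pauliZ]

theorem pauliX_kronecker_mulVec_bellTensor (v : Fin 2 → ℂ) :
    (pauliX ⊗ₖ (pauliX ⊗ₖ pauliX)) *ᵥ bellTensor v = bellTensor (pauliX *ᵥ v) := by
  ext ⟨i, j, k⟩
  fin_cases i <;> fin_cases j <;> fin_cases k <;>
    simp [mulVec, dotProduct, Fintype.sum_prod_type, bellTensor, bell, pauliX]

theorem ofReal_sqrt_two_sq : ((Real.sqrt 2 : ℝ) : ℂ) ^ 2 = 2 := by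
  rw [← Complex.ofReal_pow, Real.sq_sqrt (by norm_num)]
  norm_num

theorem star_tensorBell_dotProduct_self (ψ : Fin 2 → ℂ) :
    star (tensorBell ψ) ⬝ᵥ tensorBell ψ = star ψ ⬝ᵥ ψ := by
  have h0 : ((Real.sqrt 2 : ℝ) : ℂ) ≠ 0 := by simp
  simp [dotProduct, Fintype.sum_prod_type, tensorBell, bell]
  field_simp
  rw [ofReal_sqrt_two_sq]
  ring

theorem star_bellTensor_dotProduct_self (v : Fin 2 → ℂ) :
    star (bellTensor v) ⬝ᵥ bellTensor v = star v ⬝ᵥ v := by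
  have h0 : ((Real.sqrt 2 : ℝ) : ℂ) ≠ 0 := by simp
  simp [dotProduct, Fintype.sum_prod_type, bellTensor, bell]
  field_simp
  rw [ofReal_sqrt_two_sq]
  ring

/-- If `V` is a unitary on `ℂ²⊗ℂ²⊗ℂ²` commuting with `Π_z = Z⊗Z⊗Z` and
`Π_x = X⊗X⊗X`, and for every `ψ ∈ ℂ²` there is `v(ψ) ∈ ℂ²` with
`V(ψ ⊗ β₀₀) = β₀₀ ⊗ v(ψ)`, then there is a real `θ` with
`V(ψ ⊗ β₀₀) = e^{iθ}(β₀₀ ⊗ ψ)` for every `ψ`: the first qubit is teleported to the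
third qubit exactly, up to a global phase independent of `ψ`. -/
theorem single_qubit_teleportation_phase
    (V : Matrix (Fin 2 × Fin 2 × Fin 2) (Fin 2 × Fin 2 × Fin 2) ℂ)
    (hV1 : V * Vᴴ = 1) (hV2 : Vᴴ * V = 1)
    (hz : V * (pauliZ ⊗ₖ (pauliZ ⊗ₖ pauliZ)) = (pauliZ ⊗ₖ (pauliZ ⊗ₖ pauliZ)) * V)
    (hx : V * (pauliX ⊗ₖ (pauliX ⊗ₖ pauliX)) = (pauliX ⊗ₖ (pauliX ⊗ₖ pauliX)) * V)
    (h : ∀ ψ : Fin 2 → ℂ, ∃ v : Fin 2 → ℂ,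
      V.mulVec (fun p => ψ p.1 * bell p.2) = fun p => bell (p.1, p.2.1) * v p.2.2) :
    ∃ θ : ℝ, ∀ ψ : Fin 2 → ℂ,
      V.mulVec (fun p => ψ p.1 * bell p.2) =
        Complex.exp ((θ : ℂ) * Complex.I) • fun p => bell (p.1, p.2.1) * ψ p.2.2 := by
  change ∀ ψ, ∃ v, V *ᵥ tensorBell ψ = bellTensor v at h
  change ∃ θ : ℝ, ∀ ψ, V *ᵥ tensorBell ψ = Complex.exp ((θ : ℂ) * Complex.I) • bellTensor ψ
  choose W hW using h
  have hWz (ψ : Fin 2 → ℂ) : W (pauliZ *ᵥ ψ) = pauliZ *ᵥ W ψ := by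
    apply bellTensor_injective
    rw [← hW, ← pauliZ_kronecker_mulVec_tensorBell, mulVec_mulVec, hz, ← mulVec_mulVec, hW,
      pauliZ_kronecker_mulVec_bellTensor]
  have hWx (ψ : Fin 2 → ℂ) : W (pauliX *ᵥ ψ) = pauliX *ᵥ W ψ := by
    apply bellTensor_injective
    rw [← hW, ← pauliX_kronecker_mulVec_tensorBell, mulVec_mulVec, hx, ← mulVec_mulVec, hW,
      pauliX_kronecker_mulVec_bellTensor]
  have hWadd (ψ φ : Fin 2 → ℂ) : W (ψ + φ) = W ψ + W φ := by
    apply bellTensor_injective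
    rw [← hW, tensorBell_add, mulVec_add, hW, hW, bellTensor_add]
  have hWsmul (c : ℂ) (ψ : Fin 2 → ℂ) : W (c • ψ) = c • W ψ := by
    apply bellTensor_injective
    rw [← hW, tensorBell_smul, mulVec_smul, hW, bellTensor_smul]
  have hz0 : pauliZ *ᵥ ![1, 0] = ![1, 0] := by
    ext i
    fin_cases i <;> simp [pauliZ, mulVec, dotProduct]
  have hx0 : pauliX *ᵥ ![1, 0] = ![0, 1] := by
    ext i
    fin_cases i <;> simp [pauliX, mulVec, dotProduct]
  have hW0 : W ![1, 0] 1 = 0 := by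
    have := congrFun (hWz ![1, 0]) 1
    rw [hz0] at this
    simpa [pauliZ, mulVec, dotProduct, self_eq_neg] using this
  obtain ⟨c, hc⟩ : ∃ c : ℂ, W ![1, 0] = ![c, 0] :=
    ⟨W ![1, 0] 0, by ext i; fin_cases i <;> simp [hW0]⟩
  have hc1 : W ![0, 1] = ![0, c] := by
    rw [← hx0, hWx, hc]
    ext i
    fin_cases i <;> simp [pauliX, mulVec, dotProduct]
  have hWc (ψ : Fin 2 → ℂ) : W ψ = c • ψ := by
    have hψ : ψ = ψ 0 • ![1, 0] + ψ 1 • ![0, 1] := by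
      ext i
      fin_cases i <;> simp
    rw [hψ, hWadd, hWsmul, hWsmul, hc, hc1]
    ext i
    fin_cases i <;> simp [mul_comm]
  have hnorm : ‖c‖ = 1 := by
    have hiso : star (V *ᵥ tensorBell ![1, 0]) ⬝ᵥ (V *ᵥ tensorBell ![1, 0]) =
        star (tensorBell ![1, 0]) ⬝ᵥ tensorBell ![1, 0] := by
      rw [star_mulVec, ← dotProduct_mulVec, mulVec_mulVec, hV2, one_mulVec]
    rw [hW, star_bellTensor_dotProduct_self, star_tensorBell_dotProduct_self, hc] at hiso
    have hcc : (starRingEnd ℂ) c * c = 1 := by simpa [dotProduct] using hiso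
    rw [Complex.conj_mul'] at hcc
    have hsq : ‖c‖ ^ 2 = 1 := by exact_mod_cast hcc
    exact (pow_eq_one_iff_of_nonneg (norm_nonneg c) two_ne_zero).mp hsq
  obtain ⟨θ, hθ⟩ := (Complex.norm_eq_one_iff c).mp hnorm
  exact ⟨θ, fun ψ => by rw [hW, hWc, bellTensor_smul, hθ]⟩
end

section
/- Let V be a unitary operator on (ℂ²)^⊗3 ⊗ (ℂ²)^⊗3 that commutes with the four parity operators Π_z ⊗ 𝟙₈, 𝟙₈ ⊗ Π_z, Π_x ⊗ 𝟙₈, and 𝟙₈ ⊗ Π_x, where Π_z = Z⊗Z⊗Z and Π_x = X⊗X⊗X act on one three-qubit sector and 𝟙₈ is the identity on the other. Let Φ, Ψ : ℂ² ⊗ ℂ² → (ℂ²)^⊗3 ⊗ (ℂ²)^⊗3 be the linear maps determined on the standard basis by Φ(e_i ⊗ e_j) = (e_i ⊗ β₀₀) ⊗ (e_j ⊗ β₀₀) and Ψ(e_i ⊗ e_j) = (β₀₀ ⊗ e_i) ⊗ (β₀₀ ⊗ e_j). Suppose that for every ψ ∈ ℂ² ⊗ ℂ² there exists w(ψ) ∈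 ℂ² ⊗ ℂ² with V(Φ(ψ)) = Ψ(w(ψ)). Then there exists a real number θ such that V(Φ(ψ)) = e^{iθ} Ψ(ψ) for every ψ ∈ ℂ² ⊗ ℂ², i.e., the two-qubit state is teleported exactly, up to a global phase independent of ψ. -/
open Matrix
open scoped Kronecker

/-- One three-qubit sector. -/
abbrev Sector := Fin 2 × Fin 2 × Fin 2

/-- The linear map `Φ` determined by `Φ(e_i ⊗ e_j) = (e_i ⊗ β₀₀) ⊗ (e_j ⊗ β₀₀)`. -/
noncomputable def Phi (ψ : Fin 2 × Fin 2 → ℂ) : Sector × Sector → ℂ :=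
  fun p => ψ (p.1.1, p.2.1) * bell p.1.2 * bell p.2.2

/-- The linear map `Ψ` determined by `Ψ(e_i ⊗ e_j) = (β₀₀ ⊗ e_i) ⊗ (β₀₀ ⊗ e_j)`. -/
noncomputable def Psi (ψ : Fin 2 × Fin 2 → ℂ) : Sector × Sector → ℂ :=
  fun p => bell (p.1.1, p.1.2.1) * bell (p.2.1, p.2.2.1) * ψ (p.1.2.2, p.2.2.2)

/-- The two-sector operator `A^⊗3 ⊗ B^⊗3`. -/
def tripleKronecker (A B : Matrix (Fin 2) (Fin 2) ℂ) :
    Matrix (Sector × Sector) (Sector × Sector) ℂ :=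
  (A ⊗ₖ (A ⊗ₖ A)) ⊗ₖ (B ⊗ₖ (B ⊗ₖ B))

lemma tripleKronecker_one_right (A : Matrix (Fin 2) (Fin 2) ℂ) :
    tripleKronecker A 1 = (A ⊗ₖ (A ⊗ₖ A)) ⊗ₖ (1 : Matrix Sector Sector ℂ) := by
  simp [tripleKronecker]

lemma tripleKronecker_one_left (B : Matrix (Fin 2) (Fin 2) ℂ) :
    tripleKronecker 1 B = (1 : Matrix Sector Sector ℂ) ⊗ₖ (B ⊗ₖ (B ⊗ₖ B)) := by
  simp [tripleKronecker]

lemma pauliZ_kronecker_mulVec_bell : (pauliZ ⊗ₖ pauliZ) *ᵥ bell = bell := by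
  ext ⟨i, j⟩
  fin_cases i <;> fin_cases j <;>
    simp [mulVec, dotProduct, Fintype.sum_prod_type, bell, pauliZ]

lemma pauliX_kronecker_mulVec_bell : (pauliX ⊗ₖ pauliX) *ᵥ bell = bell := by
  ext ⟨i, j⟩
  fin_cases i <;> fin_cases j <;>
    simp [mulVec, dotProduct, Fintype.sum_prod_type, bell, pauliX]

lemma one_kronecker_mulVec_bell :
    ((1 : Matrix (Fin 2) (Fin 2) ℂ) ⊗ₖ (1 : Matrix (Fin 2) (Fin 2) ℂ)) *ᵥ bell = bell := by
  simp

lemma tripleKronecker_mulVec_Phi {A B : Matrix (Fin 2) (Fin 2) ℂ}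
    (hA : (A ⊗ₖ A) *ᵥ bell = bell) (hB : (B ⊗ₖ B) *ᵥ bell = bell) (ψ : Fin 2 × Fin 2 → ℂ) :
    tripleKronecker A B *ᵥ Phi ψ = Phi ((A ⊗ₖ B) *ᵥ ψ) := by
  ext ⟨⟨i, p⟩, ⟨j, q⟩⟩
  trans ((A ⊗ₖ B) *ᵥ ψ) (i, j) * ((A ⊗ₖ A) *ᵥ bell) p * ((B ⊗ₖ B) *ᵥ bell) q
  · simp only [tripleKronecker, mulVec, dotProduct, Fintype.sum_prod_type, Fin.sum_univ_two,
      kroneckerMap_apply, Phi]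
    ring
  · rw [hA, hB]
    simp only [Phi]

lemma tripleKronecker_mulVec_Psi {A B : Matrix (Fin 2) (Fin 2) ℂ}
    (hA : (A ⊗ₖ A) *ᵥ bell = bell) (hB : (B ⊗ₖ B) *ᵥ bell = bell) (ψ : Fin 2 × Fin 2 → ℂ) :
    tripleKronecker A B *ᵥ Psi ψ = Psi ((A ⊗ₖ B) *ᵥ ψ) := by
  ext ⟨⟨i, k, m⟩, ⟨j, l, n⟩⟩
  trans ((A ⊗ₖ B) *ᵥ ψ) (m, n) * ((A ⊗ₖ A) *ᵥ bell) (i, k) * ((B ⊗ₖ B) *ᵥ bell) (j, l)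
  · simp only [tripleKronecker, mulVec, dotProduct, Fintype.sum_prod_type, Fin.sum_univ_two,
      kroneckerMap_apply, Psi]
    ring
  · rw [hA, hB]
    simp only [Psi]
    ring

lemma sqrt_two_mul_self_complex : ((Real.sqrt 2 : ℝ) : ℂ) * ((Real.sqrt 2 : ℝ) : ℂ) = 2 := by
  rw [← Complex.ofReal_mul, Real.mul_self_sqrt zero_le_two, Complex.ofReal_ofNat]

lemma Psi_injective : Function.Injective Psi := by
  intro v w hvw
  ext ⟨a, b⟩
  have := congrFun hvw ((0, 0, a), (0, 0, b))
  simpa [Psi, bell] using this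

lemma Phi_add (v w : Fin 2 × Fin 2 → ℂ) : Phi (v + w) = Phi v + Phi w := by
  ext p
  simp only [Phi, Pi.add_apply]
  ring

lemma Phi_smul (c : ℂ) (v : Fin 2 × Fin 2 → ℂ) : Phi (c • v) = c • Phi v := by
  ext p
  simp only [Phi, Pi.smul_apply, smul_eq_mul]
  ring

lemma Psi_add (v w : Fin 2 × Fin 2 → ℂ) : Psi (v + w) = Psi v + Psi w := by
  ext p
  simp only [Psi, Pi.add_apply]
  ring

lemma Psi_smul (c : ℂ) (v : Fin 2 × Fin 2 → ℂ) : Psi (c • v) = c • Psi v := by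
  ext p
  simp only [Psi, Pi.smul_apply, smul_eq_mul]
  ring

lemma star_bell (p : Fin 2 × Fin 2) : star (bell p) = bell p := by
  simp [bell, apply_ite]

lemma sum_bell_mul_bell : ∑ p, bell p * bell p = 1 := by
  simp only [Fintype.sum_prod_type, Fin.sum_univ_two, bell]
  have h := sqrt_two_mul_self_complex
  simp [← mul_inv, h]
  norm_num

lemma star_Phi_dotProduct_Phi (ψ : Fin 2 × Fin 2 → ℂ) :
    star (Phi ψ) ⬝ᵥ Phi ψ = star ψ ⬝ᵥ ψ := by
  have h := sum_bell_mul_bell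
  trans (star ψ ⬝ᵥ ψ) * (∑ p, bell p * bell p) * (∑ p, bell p * bell p)
  · simp only [dotProduct, Pi.star_apply, Phi, star_mul', star_bell, Fintype.sum_prod_type,
      Fin.sum_univ_two]
    ring
  · rw [h, mul_one, mul_one]

lemma star_Psi_dotProduct_Psi (ψ : Fin 2 × Fin 2 → ℂ) :
    star (Psi ψ) ⬝ᵥ Psi ψ = star ψ ⬝ᵥ ψ := by
  have h := sum_bell_mul_bell
  trans (star ψ ⬝ᵥ ψ) * (∑ p, bell p * bell p) * (∑ p, bell p * bell p)
  · simp only [dotProduct, Pi.star_apply, Psi, star_mul', star_bell, Fintype.sum_prod_type,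
      Fin.sum_univ_two]
    ring
  · rw [h, mul_one, mul_one]

/-- A symmetry `A^⊗3 ⊗ B^⊗3` of `V` fixing the Bell states descends to the encoded two-qubit
states. -/
lemma mulVec_Phi_kronecker {V : Matrix (Sector × Sector) (Sector × Sector) ℂ}
    {A B : Matrix (Fin 2) (Fin 2) ℂ}
    (hA : (A ⊗ₖ A) *ᵥ bell = bell) (hB : (B ⊗ₖ B) *ᵥ bell = bell)
    (hV : V * tripleKronecker A B = tripleKronecker A B * V) {v w : Fin 2 × Fin 2 → ℂ}
    (hvw : V *ᵥ Phi v = Psi w) :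
    V *ᵥ Phi ((A ⊗ₖ B) *ᵥ v) = Psi ((A ⊗ₖ B) *ᵥ w) := by
  rw [← tripleKronecker_mulVec_Phi hA hB, mulVec_mulVec, hV, ← mulVec_mulVec, hvw,
    tripleKronecker_mulVec_Psi hA hB]

lemma pauliZ_kronecker_one_mulVec_single (j : Fin 2) :
    (pauliZ ⊗ₖ (1 : Matrix (Fin 2) (Fin 2) ℂ)) *ᵥ Pi.single (0, j) 1 = Pi.single (0, j) 1 := by
  ext ⟨a, b⟩
  fin_cases a <;> simp [pauliZ, Pi.single_apply, one_apply]

lemma one_kronecker_pauliZ_mulVec_single (i : Fin 2) :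
    ((1 : Matrix (Fin 2) (Fin 2) ℂ) ⊗ₖ pauliZ) *ᵥ Pi.single (i, 0) 1 = Pi.single (i, 0) 1 := by
  ext ⟨a, b⟩
  fin_cases b <;> simp [pauliZ, Pi.single_apply, one_apply]

lemma pauliX_kronecker_one_mulVec_single (j : Fin 2) :
    (pauliX ⊗ₖ (1 : Matrix (Fin 2) (Fin 2) ℂ)) *ᵥ Pi.single (0, j) 1 = Pi.single (1, j) 1 := by
  ext ⟨a, b⟩
  fin_cases a <;> simp [pauliX, Pi.single_apply, one_apply]

lemma one_kronecker_pauliX_mulVec_single (i : Fin 2) :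
    ((1 : Matrix (Fin 2) (Fin 2) ℂ) ⊗ₖ pauliX) *ᵥ Pi.single (i, 0) 1 = Pi.single (i, 1) 1 := by
  ext ⟨a, b⟩
  fin_cases b <;> simp [pauliX, Pi.single_apply, one_apply]

/-- If `V` is a unitary on `(ℂ²)^⊗3 ⊗ (ℂ²)^⊗3` commuting with the four
parity operators `Π_z ⊗ 𝟙₈`, `𝟙₈ ⊗ Π_z`, `Π_x ⊗ 𝟙₈`, `𝟙₈ ⊗ Π_x` and such that for every
`ψ ∈ ℂ² ⊗ ℂ²` there is `w(ψ)` with `V(Φ(ψ)) = Ψ(w(ψ))`, then there is a real `θ` with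
`V(Φ(ψ)) = e^{iθ} Ψ(ψ)` for every `ψ`: the two-qubit state is teleported exactly, up to
a global phase independent of `ψ`. -/
theorem double_teleportation_phase
    (V : Matrix (Sector × Sector) (Sector × Sector) ℂ)
    (hV1 : V * Vᴴ = 1) (hV2 : Vᴴ * V = 1)
    (hz1 : V * ((pauliZ ⊗ₖ (pauliZ ⊗ₖ pauliZ)) ⊗ₖ (1 : Matrix Sector Sector ℂ)) =
      ((pauliZ ⊗ₖ (pauliZ ⊗ₖ pauliZ)) ⊗ₖ (1 : Matrix Sector Sector ℂ)) * V)
    (hz2 : V * ((1 : Matrix Sector Sector ℂ) ⊗ₖ (pauliZ ⊗ₖ (pauliZ ⊗ₖ pauliZ))) =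
      ((1 : Matrix Sector Sector ℂ) ⊗ₖ (pauliZ ⊗ₖ (pauliZ ⊗ₖ pauliZ))) * V)
    (hx1 : V * ((pauliX ⊗ₖ (pauliX ⊗ₖ pauliX)) ⊗ₖ (1 : Matrix Sector Sector ℂ)) =
      ((pauliX ⊗ₖ (pauliX ⊗ₖ pauliX)) ⊗ₖ (1 : Matrix Sector Sector ℂ)) * V)
    (hx2 : V * ((1 : Matrix Sector Sector ℂ) ⊗ₖ (pauliX ⊗ₖ (pauliX ⊗ₖ pauliX))) =
      ((1 : Matrix Sector Sector ℂ) ⊗ₖ (pauliX ⊗ₖ (pauliX ⊗ₖ pauliX))) * V)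
    (h : ∀ ψ : Fin 2 × Fin 2 → ℂ, ∃ w : Fin 2 × Fin 2 → ℂ,
      V.mulVec (Phi ψ) = Psi w) :
    ∃ θ : ℝ, ∀ ψ : Fin 2 × Fin 2 → ℂ,
      V.mulVec (Phi ψ) = Complex.exp ((θ : ℂ) * Complex.I) • Psi ψ := by
  rw [← tripleKronecker_one_right] at hz1 hx1
  rw [← tripleKronecker_one_left] at hz2 hx2
  have bZ := pauliZ_kronecker_mulVec_bell
  have bX := pauliX_kronecker_mulVec_bell
  have b1 := one_kronecker_mulVec_bell
  obtain ⟨w, hw⟩ := h (Pi.single (0, 0) 1)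
  have hwz1 := mulVec_Phi_kronecker bZ b1 hz1 hw
  rw [pauliZ_kronecker_one_mulVec_single, hw] at hwz1
  replace hwz1 := Psi_injective hwz1
  have hwz2 := mulVec_Phi_kronecker b1 bZ hz2 hw
  rw [one_kronecker_pauliZ_mulVec_single, hw] at hwz2
  replace hwz2 := Psi_injective hwz2
  have w1 (j : Fin 2) : w (1, j) = 0 := by
    have := congrFun hwz1 (1, j)
    fin_cases j <;>
      simpa [mulVec, dotProduct, Fintype.sum_prod_type, pauliZ, self_eq_neg] using this
  have w01 : w (0, 1) = 0 := by
    have := congrFun hwz2 (0, 1)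
    simpa [mulVec, dotProduct, Fintype.sum_prod_type, pauliZ, self_eq_neg] using this
  obtain ⟨c, rfl⟩ : ∃ c : ℂ, w = c • Pi.single (0, 0) 1 := by
    refine ⟨w (0, 0), ?_⟩
    ext ⟨i, j⟩
    fin_cases i <;> fin_cases j <;> simp [w1, w01]
  have key10 := mulVec_Phi_kronecker bX b1 hx1 hw
  have key01 := mulVec_Phi_kronecker b1 bX hx2 hw
  rw [mulVec_smul, one_kronecker_pauliX_mulVec_single] at key01
  have key11 := mulVec_Phi_kronecker bX b1 hx1 key01
  rw [mulVec_smul, pauliX_kronecker_one_mulVec_single] at key10 key11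
  have hc : ‖c‖ = 1 := by
    have hnorm : star (V *ᵥ Phi (Pi.single (0, 0) 1)) ⬝ᵥ (V *ᵥ Phi (Pi.single (0, 0) 1)) =
        star (Phi (Pi.single (0, 0) 1)) ⬝ᵥ Phi (Pi.single (0, 0) 1) := by
      rw [star_mulVec, ← dotProduct_mulVec, mulVec_mulVec, hV2, one_mulVec]
    rw [hw, star_Psi_dotProduct_Psi, star_Phi_dotProduct_Phi] at hnorm
    have hcc : star c * c = 1 := by
      simpa [dotProduct, Fintype.sum_prod_type] using hnorm
    have := congrArg norm hcc
    rw [norm_mul, norm_star, norm_one] at this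
    nlinarith [norm_nonneg c]
  have hexp : Complex.exp ((c.arg : ℂ) * Complex.I) = c := by
    simpa [hc] using Complex.norm_mul_exp_arg_mul_I c
  refine ⟨c.arg, fun ψ => ?_⟩
  have hψ : ψ = ψ (0, 0) • Pi.single (0, 0) 1 + ψ (0, 1) • Pi.single (0, 1) 1 +
      ψ (1, 0) • Pi.single (1, 0) 1 + ψ (1, 1) • Pi.single (1, 1) 1 := by
    ext ⟨i, j⟩
    fin_cases i <;> fin_cases j <;> simp
  rw [hexp, hψ]
  simp only [Phi_add, Phi_smul, Psi_add, Psi_smul, mulVec_add, mulVec_smul, hw, key01, key10,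
    key11, smul_add, smul_comm c]
end

section
/- Suppose (η_i, η_f) ≠ (0, 0). For n ≥ 1, let H_mult = Σ_{k=1}^{n} 𝟙₈^{⊗(k−1)} ⊗ H₀ ⊗ 𝟙₈^{⊗(n−k)} act on (ℂ⁸)^{⊗n}, where 𝟙₈ is the 8×8 identity. Then every eigenvalue of the Hermitian matrix H_mult is of the form 2ωℏχ·j for some integer j with −n ≤ j ≤ n; the smallest eigenvalue is −2nωℏχ; and every eigenvalue other than the smallest is at least −2nωℏχ + 2ωℏχ, i.e., the spectral gap of H_mult above its ground energy equals 2ωℏχ, independently of n. -/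
open Matrix
open scoped Kronecker

/-- The operator `𝟙^{⊗(k−1)} ⊗ a ⊗ 𝟙^{⊗(N−k)}` acting on the `k`-th factor of
`(ℂ^d)^{⊗N}`. -/
noncomputable def localOp {d : Type*} [Fintype d] [DecidableEq d] {N : ℕ}
    (k : Fin N) (a : Matrix d d ℂ) : Matrix (Fin N → d) (Fin N → d) ℂ :=
  Matrix.of fun x y => a (x k) (y k) *
    ∏ j ∈ Finset.univ.erase k, (1 : Matrix d d ℂ) (x j) (y j)

/-- `H_mult = Σ_{k=1}^{n} 𝟙₈^{⊗(k−1)} ⊗ H₀ ⊗ 𝟙₈^{⊗(n−k)}` on `(ℂ⁸)^{⊗n}`. -/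
noncomputable def Hmult (ω ℏ ηi ηf : ℝ) (N : ℕ) :
    Matrix (Fin N → Fin 2 × Fin 2 × Fin 2) (Fin N → Fin 2 × Fin 2 × Fin 2) ℂ :=
  ∑ k : Fin N, localOp k (H₀tel ω ℏ ηi ηf)

section TensorFamily

variable {d : Type*} {N : ℕ}

/-- The tensor product `f 0 ⊗ ⋯ ⊗ f (N - 1)` of a family of matrices. -/
noncomputable def tensorFamily (f : Fin N → Matrix d d ℂ) :
    Matrix (Fin N → d) (Fin N → d) ℂ :=
  Matrix.of fun x y => ∏ j, f j (x j) (y j)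

lemma tensorFamily_mul [Fintype d] (f g : Fin N → Matrix d d ℂ) :
    tensorFamily f * tensorFamily g = tensorFamily (f * g) := by
  ext x y
  simp only [tensorFamily, Matrix.mul_apply, Matrix.of_apply, Pi.mul_apply,
    Finset.prod_univ_sum, Fintype.piFinset_univ, Finset.prod_mul_distrib]

lemma tensorFamily_one [DecidableEq d] : tensorFamily (1 : Fin N → Matrix d d ℂ) = 1 := by
  ext x y
  simp only [tensorFamily, Matrix.of_apply, Pi.one_apply, Matrix.one_apply, funext_iff]
  rw [Finset.prod_ite_zero]
  simp

variable [Fintype d] [DecidableEq d]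

lemma localOp_eq_tensorFamily (k : Fin N) (a : Matrix d d ℂ) :
    localOp k a = tensorFamily (Function.update 1 k a) := by
  ext x y
  simp only [localOp, tensorFamily, Matrix.of_apply]
  rw [← Finset.mul_prod_erase Finset.univ _ (Finset.mem_univ k), Function.update_self]
  congr 1
  refine Finset.prod_congr rfl fun j hj => ?_
  rw [Function.update_of_ne (Finset.ne_of_mem_erase hj), Pi.one_apply]

lemma localOp_diagonal (k : Fin N) (v : d → ℂ) :
    localOp k (diagonal v) = diagonal fun x => v (x k) := by
  ext x y
  simp only [localOp, Matrix.of_apply]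
  by_cases h : x = y
  · subst h; simp
  · rw [diagonal_apply_ne _ h]
    obtain ⟨j, hj⟩ := Function.ne_iff.mp h
    by_cases hjk : j = k
    · subst hjk; simp [hj]
    · exact mul_eq_zero_of_right _ (Finset.prod_eq_zero
        (Finset.mem_erase.mpr ⟨hjk, Finset.mem_univ j⟩) (Matrix.one_apply_ne hj))

lemma localOp_isHermitian (k : Fin N) {a : Matrix d d ℂ} (ha : a.IsHermitian) :
    (localOp k a).IsHermitian := by
  ext x y
  simp only [localOp, conjTranspose_apply, Matrix.of_apply, star_mul', star_prod]
  rw [ha.apply]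
  congr 1
  exact Finset.prod_congr rfl fun j _ => isHermitian_one.apply _ _

/-- Conjugating every factor by the same pair of mutually inverse matrices conjugates
a local operator. -/
lemma tensorFamily_mul_localOp_mul {u v : Matrix d d ℂ} (huv : u * v = 1) (k : Fin N)
    (a : Matrix d d ℂ) :
    tensorFamily (fun _ => u) * localOp k a * tensorFamily (fun _ => v) =
      localOp k (u * a * v) := by
  simp only [localOp_eq_tensorFamily, tensorFamily_mul]
  congr 1
  funext j
  by_cases hj : j = k
  · subst hj; simp
  · simp [Function.update_of_ne hj, huv]

/-- The spectrum of a sum of copies of a Hermitian matrix, one for each tensor factor. -/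
lemma spectrum_sum_localOp {a : Matrix d d ℂ} (ha : a.IsHermitian) :
    spectrum ℂ (∑ k : Fin N, localOp k a) =
      Set.range fun x : Fin N → d => ((∑ k, ha.eigenvalues (x k) : ℝ) : ℂ) := by
  set u : Matrix d d ℂ := (ha.eigenvectorUnitary : Matrix d d ℂ)
  have huv : u * star u = 1 := Unitary.coe_mul_star_self _
  have hvu : star u * u = 1 := Unitary.coe_star_mul_self _
  let U : (Matrix (Fin N → d) (Fin N → d) ℂ)ˣ :=
    { val := tensorFamily fun _ => u
      inv := tensorFamily fun _ => star u
      val_inv := by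
        rw [tensorFamily_mul, ← tensorFamily_one]
        exact congrArg tensorFamily (funext fun _ => huv)
      inv_val := by
        rw [tensorFamily_mul, ← tensorFamily_one]
        exact congrArg tensorFamily (funext fun _ => hvu) }
  have hdiag : ∑ k : Fin N, localOp k a =
      (U : Matrix (Fin N → d) (Fin N → d) ℂ) *
        diagonal (fun x => ((∑ k, ha.eigenvalues (x k) : ℝ) : ℂ)) *
        ((U⁻¹ : (Matrix (Fin N → d) (Fin N → d) ℂ)ˣ) : Matrix (Fin N → d) (Fin N → d) ℂ) := by
    have hsum : diagonal (fun x : Fin N → d => ((∑ k, ha.eigenvalues (x k) : ℝ) : ℂ)) =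
        ∑ k, localOp k (diagonal fun i => (ha.eigenvalues i : ℂ)) := by
      simp only [localOp_diagonal]
      ext x y
      by_cases h : x = y
      · subst h; simp [Matrix.sum_apply]
      · simp [Matrix.sum_apply, h]
    rw [hsum, Finset.mul_sum, Finset.sum_mul]
    refine Finset.sum_congr rfl fun k _ => ?_
    refine Eq.trans ?_ (tensorFamily_mul_localOp_mul huv k _).symm
    congr 1
    conv_lhs => rw [ha.spectral_theorem, Unitary.conjStarAlgAut_apply]
    rfl
  rw [hdiag, spectrum.units_conjugate, spectrum_diagonal]

end TensorFamily

lemma H₀tel_isHermitian (ω ℏ ηi ηf : ℝ) : (H₀tel ω ℏ ηi ηf).IsHermitian := by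
  have hX : pauliXᴴ = pauliX := by
    ext i j; fin_cases i <;> fin_cases j <;> simp [pauliX]
  have hZ : pauliZᴴ = pauliZ := by
    ext i j; fin_cases i <;> fin_cases j <;> simp [pauliZ]
  simp [Matrix.IsHermitian, H₀tel, conjTranspose_smul, conjTranspose_kronecker, hX, hZ]

lemma H₀tel_mulVec_apply (ω ℏ ηi ηf : ℝ) (v : Fin 2 × Fin 2 × Fin 2 → ℂ) (a b c : Fin 2) :
    (H₀tel ω ℏ ηi ηf *ᵥ v) (a, b, c) =
      -(ω * ℏ) * (ηi * (v (a, b + 1, c + 1) + pauliZ b b * pauliZ c c * v (a, b, c)) +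
        ηf * (v (a + 1, b + 1, c) + pauliZ a a * pauliZ b b * v (a, b, c))) := by
  simp only [mulVec, dotProduct, Fintype.sum_prod_type, Fin.sum_univ_two]
  fin_cases a <;> fin_cases b <;> fin_cases c <;> simp [H₀tel, pauliX, pauliZ] <;> ring

lemma H₀tel_mulVec_mulVec_mulVec (ω ℏ ηi ηf : ℝ) (v : Fin 2 × Fin 2 × Fin 2 → ℂ) :
    H₀tel ω ℏ ηi ηf *ᵥ (H₀tel ω ℏ ηi ηf *ᵥ (H₀tel ω ℏ ηi ηf *ᵥ v)) =
      ((4 * (ω * ℏ) ^ 2 * (ηi ^ 2 + ηf ^ 2) : ℝ) : ℂ) • (H₀tel ω ℏ ηi ηf *ᵥ v) := by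
  ext ⟨a, b, c⟩
  simp only [H₀tel_mulVec_apply, Pi.smul_apply, smul_eq_mul]
  fin_cases a <;> fin_cases b <;> fin_cases c <;> simp [pauliZ] <;> ring

lemma H₀tel_trace (ω ℏ ηi ηf : ℝ) : (H₀tel ω ℏ ηi ηf).trace = 0 := by
  simp [H₀tel, trace_kronecker, pauliX, pauliZ, Matrix.trace_fin_two]

lemma H₀tel_ne_zero {ω ℏ ηi ηf : ℝ} (hω : 0 < ω) (hℏ : 0 < ℏ) (hη : ¬(ηi = 0 ∧ ηf = 0)) :
    H₀tel ω ℏ ηi ηf ≠ 0 := by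
  intro h
  have h₁ := congrFun (congrFun h (0, 0, 0)) (0, 1, 1)
  have h₂ := congrFun (congrFun h (0, 0, 0)) (1, 1, 0)
  simp [H₀tel, pauliX, pauliZ, hω.ne', hℏ.ne'] at h₁ h₂
  exact hη ⟨h₁, h₂⟩

lemma H₀tel_eigenvalues {ω ℏ ηi ηf : ℝ}
    (hH : (H₀tel ω ℏ ηi ηf).IsHermitian) (i : Fin 2 × Fin 2 × Fin 2) :
    ∃ j : ℤ, -1 ≤ j ∧ j ≤ 1 ∧
      hH.eigenvalues i = 2 * ω * ℏ * Real.sqrt (ηi ^ 2 + ηf ^ 2) * j := by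
  set e := hH.eigenvalues i
  set χ := Real.sqrt (ηi ^ 2 + ηf ^ 2)
  have hχ : χ ^ 2 = ηi ^ 2 + ηf ^ 2 := Real.sq_sqrt (by positivity)
  set v : Fin 2 × Fin 2 × Fin 2 → ℂ := ⇑(hH.eigenvectorBasis i)
  have hv : v ≠ 0 := by
    intro h
    apply hH.eigenvectorBasis.orthonormal.ne_zero i
    ext j
    exact congrFun h j
  have hHv : H₀tel ω ℏ ηi ηf *ᵥ v = (e : ℂ) • v := by
    simpa using hH.mulVec_eigenvectorBasis i
  have h3 := H₀tel_mulVec_mulVec_mulVec ω ℏ ηi ηf v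
  simp only [hHv, mulVec_smul, smul_smul] at h3
  have h4 := smul_left_injective ℂ hv h3
  have h5 : e * e * e = 4 * (ω * ℏ) ^ 2 * (ηi ^ 2 + ηf ^ 2) * e := by exact_mod_cast h4
  have h6 : e * ((e - 2 * ω * ℏ * χ) * (e + 2 * ω * ℏ * χ)) = 0 := by
    rw [← hχ] at h5; linear_combination h5
  rcases mul_eq_zero.mp h6 with h | h
  · exact ⟨0, by norm_num, by norm_num, by simpa using h⟩
  rcases mul_eq_zero.mp h with h | h
  · exact ⟨1, by norm_num, by norm_num, by push_cast; linarith⟩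
  · exact ⟨-1, by norm_num, by norm_num, by push_cast; linarith⟩

lemma H₀tel_exists_eigenvalue_eq_neg {ω ℏ ηi ηf : ℝ} (hω : 0 < ω) (hℏ : 0 < ℏ)
    (hη : ¬(ηi = 0 ∧ ηf = 0)) (hH : (H₀tel ω ℏ ηi ηf).IsHermitian) :
    ∃ i, hH.eigenvalues i = -(2 * ω * ℏ * Real.sqrt (ηi ^ 2 + ηf ^ 2)) := by
  by_contra! hne
  have hnonneg : ∀ i, 0 ≤ hH.eigenvalues i := by
    intro i
    obtain ⟨j, hj₁, hj₂, hj⟩ := H₀tel_eigenvalues hH i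
    have hj₀ : 0 ≤ j := by
      by_contra! h
      obtain rfl : j = -1 := by omega
      exact hne i (by rw [hj]; push_cast; ring)
    have : (0 : ℝ) ≤ j := by exact_mod_cast hj₀
    rw [hj]
    positivity
  have hsum : ∑ i, hH.eigenvalues i = 0 := by
    have := hH.trace_eq_sum_eigenvalues
    rw [H₀tel_trace] at this
    refine Complex.ofReal_injective ?_
    simpa using this.symm
  have hzero := (Finset.sum_eq_zero_iff_of_nonneg fun i _ => hnonneg i).mp hsum
  exact H₀tel_ne_zero hω hℏ hη
    (hH.eigenvalues_eq_zero_iff.mp (funext fun i => hzero i (Finset.mem_univ i)))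

/-- For `(η_i, η_f) ≠ (0,0)` and `n ≥ 1`, the Hermitian matrix `H_mult`
has all eigenvalues of the form `2ωℏχ·j` with `j ∈ ℤ`, `−n ≤ j ≤ n`; its smallest
eigenvalue is `−2nωℏχ`; and every other eigenvalue is at least `−2nωℏχ + 2ωℏχ`:
the spectral gap above the ground energy equals `2ωℏχ`, independently of `n`. -/
theorem Hmult_spectrum_and_gap (ω ℏ ηi ηf : ℝ) (hω : 0 < ω) (hℏ : 0 < ℏ)
    (hη : ¬(ηi = 0 ∧ ηf = 0)) (N : ℕ) (hN : 1 ≤ N) :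
    (Hmult ω ℏ ηi ηf N).IsHermitian ∧
    (∀ μ ∈ spectrum ℂ (Hmult ω ℏ ηi ηf N), ∃ j : ℤ, -(N : ℤ) ≤ j ∧ j ≤ (N : ℤ) ∧
      μ = ((2 * ω * ℏ * Real.sqrt (ηi ^ 2 + ηf ^ 2) * (j : ℝ) : ℝ) : ℂ)) ∧
    ((-(2 * (N : ℝ) * ω * ℏ * Real.sqrt (ηi ^ 2 + ηf ^ 2)) : ℂ) ∈
      spectrum ℂ (Hmult ω ℏ ηi ηf N)) ∧
    (∀ μ ∈ spectrum ℂ (Hmult ω ℏ ηi ηf N),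
      -(2 * (N : ℝ) * ω * ℏ * Real.sqrt (ηi ^ 2 + ηf ^ 2)) ≤ μ.re) ∧
    (∀ μ ∈ spectrum ℂ (Hmult ω ℏ ηi ηf N),
      μ ≠ ((-(2 * (N : ℝ) * ω * ℏ * Real.sqrt (ηi ^ 2 + ηf ^ 2)) : ℝ) : ℂ) →
      -(2 * (N : ℝ) * ω * ℏ * Real.sqrt (ηi ^ 2 + ηf ^ 2))
        + 2 * ω * ℏ * Real.sqrt (ηi ^ 2 + ηf ^ 2) ≤ μ.re) := by
  have hH := H₀tel_isHermitian ω ℏ ηi ηf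
  have hspec : spectrum ℂ (Hmult ω ℏ ηi ηf N) = _ := spectrum_sum_localOp hH
  set c := 2 * ω * ℏ * Real.sqrt (ηi ^ 2 + ηf ^ 2) with hc
  have hc₀ : 0 ≤ c := by positivity
  have hmin : -(2 * (N : ℝ) * ω * ℏ * Real.sqrt (ηi ^ 2 + ηf ^ 2)) = c * (-N : ℝ) := by
    rw [hc]; ring
  have hform : ∀ μ ∈ spectrum ℂ (Hmult ω ℏ ηi ηf N), ∃ j : ℤ, -(N : ℤ) ≤ j ∧ j ≤ (N : ℤ) ∧
      μ = ((c * (j : ℝ) : ℝ) : ℂ) := by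
    rw [hspec]
    rintro _ ⟨x, rfl⟩
    choose j hj₁ hj₂ hj using fun k => H₀tel_eigenvalues hH (x k)
    refine ⟨∑ k, j k, ?_, ?_, ?_⟩
    · simpa using Finset.sum_le_sum fun k (_ : k ∈ Finset.univ) => hj₁ k
    · simpa using Finset.sum_le_sum fun k (_ : k ∈ Finset.univ) => hj₂ k
    · simp only [hj, Int.cast_sum, Finset.mul_sum, hc]
  refine ⟨isSelfAdjoint_sum _ fun k _ => localOp_isHermitian k hH, hform, ?_, ?_, ?_⟩
  · obtain ⟨i, hi⟩ := H₀tel_exists_eigenvalue_eq_neg hω hℏ hη hH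
    rw [hspec]
    refine ⟨fun _ => i, ?_⟩
    simp only [hi, Finset.sum_const, Finset.card_univ, Fintype.card_fin, nsmul_eq_mul]
    push_cast
    ring
  · intro μ hμ
    obtain ⟨j, hj, -, rfl⟩ := hform μ hμ
    rw [hmin, Complex.ofReal_re]
    exact mul_le_mul_of_nonneg_left (by exact_mod_cast hj) hc₀
  · intro μ hμ hne
    obtain ⟨j, hj, -, rfl⟩ := hform μ hμ
    rw [hmin] at hne ⊢
    have hj' : -(N : ℤ) + 1 ≤ j := by
      have : j ≠ -(N : ℤ) := by
        rintro rfl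
        exact hne (by push_cast; rfl)
      omega
    have hj'' : -(N : ℝ) + 1 ≤ j := by exact_mod_cast hj'
    rw [Complex.ofReal_re]
    linarith [mul_le_mul_of_nonneg_left hj'' hc₀]
end

section
/- Let h : [0, 1] → M₈(ℂ) be a continuous family of 8×8 complex matrices with Tr[h(s)] = 0 for every s, and for n ≥ 1 let H_mult(s) = Σ_{k=1}^{n} 𝟙₈^{⊗(k−1)} ⊗ h(s) ⊗ 𝟙₈^{⊗(n−k)} on (ℂ⁸)^{⊗n}. Then the energetic cost of the n-sector evolution satisfies Σ_n = g_n · Σ_single with g_n = √(2^{3(n−1)} n), i.e., ∫₀¹ ‖H_mult(s)‖ ds = √(2^{3(n−1)} n) ∫₀¹ ‖h(s)‖ ds. -/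
open Matrix

/-- The Hilbert–Schmidt norm `‖A‖ = √(Tr[A† A])`. -/
noncomputable def hsNorm {m : Type*} [Fintype m] (A : Matrix m m ℂ) : ℝ :=
  Real.sqrt ((Aᴴ * A).trace.re)

/-- The Kronecker product of a finite family of square matrices. -/
def piKronecker {ι d R : Type*} [Fintype ι] [CommMonoid R] (A : ι → Matrix d d R) :
    Matrix (ι → d) (ι → d) R :=
  Matrix.of fun x y => ∏ j, A j (x j) (y j)

lemma trace_conjTranspose_piKronecker_mul {ι d R : Type*} [Fintype ι] [DecidableEq ι] [Fintype d]
    [CommSemiring R] [StarRing R] (A B : ι → Matrix d d R) :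
    ((piKronecker A)ᴴ * piKronecker B).trace = ∏ j, ((A j)ᴴ * B j).trace := by
  simp only [Matrix.trace, Matrix.diag_apply, Matrix.mul_apply, Matrix.conjTranspose_apply,
    piKronecker, Matrix.of_apply, star_prod, ← Finset.prod_mul_distrib, Fintype.prod_sum]

lemma localOp_eq_piKronecker {d : Type*} [Fintype d] [DecidableEq d] {N : ℕ}
    (k : Fin N) (a : Matrix d d ℂ) :
    localOp k a = piKronecker (Function.update (fun _ => 1) k a) := by
  ext x y
  simp only [localOp, piKronecker, Matrix.of_apply]
  rw [← Finset.mul_prod_erase Finset.univ _ (Finset.mem_univ k), Function.update_self]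
  congr 1
  refine Finset.prod_congr rfl fun j hj => ?_
  rw [Function.update_of_ne (Finset.ne_of_mem_erase hj)]

lemma trace_conjTranspose_localOp_mul_self {d : Type*} [Fintype d] [DecidableEq d] {N : ℕ}
    (k : Fin N) (a : Matrix d d ℂ) :
    ((localOp k a)ᴴ * localOp k a).trace =
      (Fintype.card d : ℂ) ^ (N - 1) * (aᴴ * a).trace := by
  rw [localOp_eq_piKronecker, trace_conjTranspose_piKronecker_mul,
    ← Finset.prod_erase_mul Finset.univ _ (Finset.mem_univ k), Function.update_self]
  congr 1
  rw [Finset.prod_congr rfl (g := fun _ => (Fintype.card d : ℂ))]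
  · simp [Finset.card_erase_of_mem]
  · intro j hj
    rw [Function.update_of_ne (Finset.ne_of_mem_erase hj)]
    simp

lemma trace_conjTranspose_localOp_mul_of_ne {d : Type*} [Fintype d] [DecidableEq d] {N : ℕ}
    {k l : Fin N} (hkl : k ≠ l) {a : Matrix d d ℂ} (ha : a.trace = 0) (b : Matrix d d ℂ) :
    ((localOp k a)ᴴ * localOp l b).trace = 0 := by
  rw [localOp_eq_piKronecker, localOp_eq_piKronecker, trace_conjTranspose_piKronecker_mul]
  refine Finset.prod_eq_zero (Finset.mem_univ k) ?_
  rw [Function.update_self, Function.update_of_ne hkl, mul_one, Matrix.trace_conjTranspose, ha,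
    star_zero]

lemma hsNorm_sum_localOp {d : Type*} [Fintype d] [DecidableEq d] (N : ℕ)
    {a : Matrix d d ℂ} (ha : a.trace = 0) :
    hsNorm (∑ k : Fin N, localOp k a) =
      Real.sqrt ((Fintype.card d : ℝ) ^ (N - 1) * N) * hsNorm a := by
  have key : ((∑ k : Fin N, localOp k a)ᴴ * ∑ k : Fin N, localOp k a).trace =
      (((Fintype.card d : ℝ) ^ (N - 1) * N : ℝ) : ℂ) * (aᴴ * a).trace := by
    rw [Matrix.conjTranspose_sum, Finset.sum_mul_sum, Matrix.trace_sum]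
    have row (k : Fin N) : (∑ l : Fin N, (localOp k a)ᴴ * localOp l a).trace =
        (Fintype.card d : ℂ) ^ (N - 1) * (aᴴ * a).trace := by
      rw [Matrix.trace_sum, Finset.sum_eq_single k, trace_conjTranspose_localOp_mul_self]
      · exact fun l _ hl => trace_conjTranspose_localOp_mul_of_ne hl.symm ha a
      · simp
    simp only [row, Finset.sum_const, Finset.card_univ, Fintype.card_fin, nsmul_eq_mul]
    push_cast
    ring
  rw [hsNorm, hsNorm, key, Complex.re_ofReal_mul, Real.sqrt_mul (by positivity)]

/-- For a continuous family `h(s)` of traceless 8×8 matrices and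
`H_mult(s) = Σ_{k=1}^n 𝟙₈^{⊗(k−1)} ⊗ h(s) ⊗ 𝟙₈^{⊗(n−k)}` on `(ℂ⁸)^{⊗n}`, the energetic
cost satisfies `Σ_n = √(2^{3(n−1)} n) · Σ_single`, i.e.
`∫₀¹ ‖H_mult(s)‖ ds = √(2^{3(n−1)} n) ∫₀¹ ‖h(s)‖ ds`. -/
theorem cost_n_sector (N : ℕ) (hN : 1 ≤ N)
    (h : ℝ → Matrix (Fin 2 × Fin 2 × Fin 2) (Fin 2 × Fin 2 × Fin 2) ℂ)
    (hcont : ContinuousOn h (Set.Icc 0 1))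
    (htr : ∀ s ∈ Set.Icc (0 : ℝ) 1, (h s).trace = 0) :
    ∫ s in (0 : ℝ)..1, hsNorm (∑ k : Fin N, localOp k (h s)) =
      Real.sqrt (2 ^ (3 * (N - 1)) * N) * ∫ s in (0 : ℝ)..1, hsNorm (h s) := by
  rw [← intervalIntegral.integral_const_mul]
  refine intervalIntegral.integral_congr fun s hs => ?_
  rw [Set.uIcc_of_le zero_le_one] at hs
  have hcard : (Fintype.card (Fin 2 × Fin 2 × Fin 2) : ℝ) = 2 ^ 3 := by norm_num
  simp only [hsNorm_sum_localOp N (htr s hs), hcard, ← pow_mul]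
end
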